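/- Let n ≥ 0 and let y : Fin (n+2) → ℝ satisfy 0 ≤ y(i) ≤ 1 for all i and y(0) + y(1) ≤ 1. Define z : Fin (n+1) → ℝ by z(0) := y(0) + y(1) and z(i+1) := y(i+2) for i < n, and suppose 0 ≤ z(i) ≤ 1 for all i. Then Y(y) ≥ Y(z), where for a vector v : Fin m → [0,1], Y(v) := Σ_{S ⊆ Fin m} (1/(|S|+1)) · (Π_{i∈S} v(i)) · (Π_{i∉S} (1 − v(i))). -/

import Mathlib

/-- `Ypb m v = E[1/(K+1)]` where `K` is the Poisson binomial random variable
with success probabilities `v 0, …, v (m-1)`. -/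
noncomputable def Ypb (m : ℕ) (v : Fin m → ℝ) : ℝ :=
  ∑ S : Finset (Fin m),
    (1 / ((S.card : ℝ) + 1)) * (∏ i ∈ S, v i) * (∏ i ∈ Sᶜ, (1 - v i))

/-- `E[1/(K+1)]` is the integral over `[0, 1]` of the probability generating function of `K`. -/
theorem Ypb_eq_integral (m : ℕ) (v : Fin m → ℝ) :
    Ypb m v = ∫ t in (0 : ℝ)..1, ∏ i, (v i * t + (1 - v i)) := by
  have h (t : ℝ) : ∏ i, (v i * t + (1 - v i)) =
      ∑ S : Finset (Fin m), t ^ S.card * ((∏ i ∈ S, v i) * ∏ i ∈ Sᶜ, (1 - v i)) := by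
    rw [Fintype.prod_add]
    refine Finset.sum_congr rfl fun S _ => ?_
    rw [Finset.prod_mul_distrib, Finset.prod_const]
    ring
  simp_rw [h]
  rw [intervalIntegral.integral_finsetSum
    fun S _ => Continuous.intervalIntegrable (by fun_prop) 0 1]
  refine Finset.sum_congr rfl fun S _ => ?_
  rw [intervalIntegral.integral_mul_const, integral_pow]
  simp [mul_assoc]

/-- Merging two coordinates `y 0` and `y 1` into their sum does not increase
`Ypb`. -/
theorem Ypb_merge_le
    (n : ℕ) (y : Fin (n + 2) → ℝ)
    (hy : ∀ i, 0 ≤ y i ∧ y i ≤ 1)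
    (hsum : y 0 + y 1 ≤ 1)
    (z : Fin (n + 1) → ℝ)
    (hz0 : z 0 = y 0 + y 1)
    (hzsucc : ∀ i : Fin n, z i.succ = y i.succ.succ)
    (hz : ∀ i, 0 ≤ z i ∧ z i ≤ 1) :
    Ypb (n + 1) z ≤ Ypb (n + 2) y := by
  rw [Ypb_eq_integral, Ypb_eq_integral]
  refine intervalIntegral.integral_mono_on zero_le_one
    (Continuous.intervalIntegrable (by fun_prop) 0 1)
    (Continuous.intervalIntegrable (by fun_prop) 0 1) fun t ht => ?_
  rw [Fin.prod_univ_succ, Fin.prod_univ_succ (n := n + 1), Fin.prod_univ_succ (n := n),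
    ← mul_assoc]
  simp only [hz0, hzsucc, Fin.succ_zero_eq_one]
  refine mul_le_mul_of_nonneg_right ?_ (Finset.prod_nonneg fun i _ =>
    add_nonneg (mul_nonneg (hy _).1 ht.1) (sub_nonneg.2 (hy _).2))
  have hnonneg : 0 ≤ y 0 * y 1 * (1 - t) ^ 2 :=
    mul_nonneg (mul_nonneg (hy 0).1 (hy 1).1) (sq_nonneg _)
  linarith
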